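/- arXiv:1602.04562 — 4 statements merged into one kernel-verified Lean document; each statement's English description precedes it below -/
import Mathlib

section
/- Let R be a commutative ring, p ≥ 1, n = 2^p, and ω ∈ R with ω^{n/2} = −1. Let a ∈ R^n and let x_0, …, x_p ∈ R^n be the family defined by the butterfly recurrence. Then for every s with 0 ≤ s ≤ p, setting m_s = 2^{p−s}, and for every i with 0 ≤ i < n/m_s and every j with 0 ≤ j < m_s, one has x_{s, i·m_s + j} = DFT_{ω^{m_s}}(a_j, a_{m_s+j}, a_{2m_s+j}, …, a_{n−m_s+j})_{[i]_s}, where the DFT is of the length-2^s vector (a_{k·m_s+j})_{0≤k<2^s} with respect to ω^{m_s}, and [i]_s is the length-s bitwise reverse of i. -/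
/-- The discrete Fourier transform of a length-`n` vector (given as a function `ℕ → R`
restricted to indices `< n`) with respect to `ω`:  `(dft n ω a) i = ∑_{j<n} a j * ω^(i*j)`. -/
def dft {R : Type*} [CommRing R] (n : ℕ) (ω : R) (a : ℕ → R) (i : ℕ) : R :=
  ∑ j ∈ Finset.range n, a j * ω ^ (i * j)

/-- `bitrev p i` is the length-`p` bitwise reverse `[i]_p` of `i`. -/
def bitrev : ℕ → ℕ → ℕ
  | 0, _ => 0
  | p + 1, i => (i % 2) * 2 ^ p + bitrev p (i / 2)

theorem dft_two_mul {R : Type*} [CommRing R] (n : ℕ) (ζ : R) (b : ℕ → R) (r : ℕ) :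
    dft (2 * n) ζ b r =
      dft n (ζ ^ 2) (fun k => b (2 * k)) r + ζ ^ r * dft n (ζ ^ 2) (fun k => b (2 * k + 1)) r := by
  unfold dft
  induction n with
  | zero => simp
  | succ n ih =>
    rw [show 2 * (n + 1) = 2 * n + 1 + 1 by ring, Finset.sum_range_succ, Finset.sum_range_succ, ih,
      Finset.sum_range_succ, Finset.sum_range_succ]
    ring

theorem dft_add_of_pow_eq_neg_one {R : Type*} [CommRing R] {n : ℕ} {ζ : R} (hζ : ζ ^ n = -1)
    (b : ℕ → R) (r : ℕ) :
    dft (2 * n) ζ b (n + r) =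
      dft n (ζ ^ 2) (fun k => b (2 * k)) r - ζ ^ r * dft n (ζ ^ 2) (fun k => b (2 * k + 1)) r := by
  have periodic (c : ℕ → R) : dft n (ζ ^ 2) c (n + r) = dft n (ζ ^ 2) c r := by
    have h : (ζ ^ 2) ^ n = 1 := by rw [← pow_mul, mul_comm, pow_mul, hζ, neg_one_sq]
    simp only [dft, add_mul, pow_add, pow_mul, h, one_pow, one_mul]
  rw [dft_two_mul, periodic, periodic, pow_add, hζ]
  ring

theorem bitrev_succ_two_mul (s i : ℕ) : bitrev (s + 1) (2 * i) = bitrev s i := by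
  simp [bitrev]

theorem bitrev_succ_two_mul_add_one (s i : ℕ) :
    bitrev (s + 1) (2 * i + 1) = 2 ^ s + bitrev s i := by
  have h : (2 * i + 1) / 2 = i := by lia
  simp [bitrev, h]

/-- The entries computed by the butterfly recurrence of the in-place FFT are values of
appropriate sub-DFTs: `x_{s, i·m_s + j} = DFT_{ω^{m_s}}((a_{k·m_s+j})_{k<2^s})_{[i]_s}`
for all `0 ≤ s ≤ p`, `i < 2^s = n/m_s`, `j < m_s = 2^{p-s}`. -/
theorem butterfly_computes_subDFTs {R : Type*} [CommRing R]
    (p : ℕ) (hp : 1 ≤ p) (ω : R) (hω : ω ^ (2 ^ (p - 1)) = -1)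
    (a : ℕ → R) (x : ℕ → ℕ → R)
    (hx0 : ∀ i < 2 ^ p, x 0 i = a i)
    (hxs : ∀ s, 1 ≤ s → s ≤ p → ∀ i j, Even i → i < 2 ^ s → j < 2 ^ (p - s) →
      x s (i * 2 ^ (p - s) + j) =
          x (s - 1) (i * 2 ^ (p - s) + j)
            + ω ^ (bitrev s i * 2 ^ (p - s)) * x (s - 1) ((i + 1) * 2 ^ (p - s) + j) ∧
      x s ((i + 1) * 2 ^ (p - s) + j) =
          x (s - 1) (i * 2 ^ (p - s) + j)
            - ω ^ (bitrev s i * 2 ^ (p - s)) * x (s - 1) ((i + 1) * 2 ^ (p - s) + j)) :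
    ∀ s ≤ p, ∀ i < 2 ^ s, ∀ j < 2 ^ (p - s),
      x s (i * 2 ^ (p - s) + j) =
        dft (2 ^ s) (ω ^ (2 ^ (p - s))) (fun k => a (k * 2 ^ (p - s) + j)) (bitrev s i) := by
  intro s
  induction s with
  | zero =>
    intro _ i hi j hj
    obtain rfl : i = 0 := by simpa using hi
    simpa [dft, bitrev] using hx0 j hj
  | succ s ih =>
    intro hs i hi j hj
    have hm : 2 ^ (p - s) = 2 * 2 ^ (p - (s + 1)) := by
      rw [← pow_succ']
      congr 1
      lia
    have hζ : (ω ^ 2 ^ (p - (s + 1))) ^ 2 ^ s = -1 := by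
      rw [← pow_mul, ← pow_add, ← hω]
      congr 2
      lia
    have ih' := ih (by lia)
    rw [hm] at ih'
    have hstep := hxs (s + 1) (by lia) hs
    simp only [Nat.add_sub_cancel] at hstep
    generalize 2 ^ (p - (s + 1)) = m at *
    have hω2 : ω ^ (2 * m) = (ω ^ m) ^ 2 := by rw [← pow_mul, mul_comm]
    obtain ⟨i, rfl | rfl⟩ := i.even_or_odd'
    all_goals
      have hi' : i < 2 ^ s := by lia
      obtain ⟨hadd, hsub⟩ := hstep (2 * i) j (even_two_mul i) (by lia) hj
      have heven := ih' i hi' j (by lia)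
      have hodd := ih' i hi' (m + j) (by lia)
      rw [show i * (2 * m) + j = 2 * i * m + j by ring, hω2] at heven
      rw [show i * (2 * m) + (m + j) = (2 * i + 1) * m + j by ring, hω2] at hodd
      have heven_index (k : ℕ) : 2 * k * m + j = k * (2 * m) + j := by ring
      have hodd_index (k : ℕ) : (2 * k + 1) * m + j = k * (2 * m) + (m + j) := by ring
      have htwiddle : ω ^ (bitrev s i * m) = (ω ^ m) ^ bitrev s i := by rw [← pow_mul, mul_comm]
      rw [bitrev_succ_two_mul, heven, hodd, htwiddle] at hadd hsub
    · rw [hadd, bitrev_succ_two_mul, pow_succ' 2 s, dft_two_mul]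
      simp only [heven_index, hodd_index]
    · rw [hsub, bitrev_succ_two_mul_add_one, pow_succ' 2 s, dft_add_of_pow_eq_neg_one hζ]
      simp only [heven_index, hodd_index]
end

section
/- Let p ≥ 1, n = 2^p, and let ℓ be a natural number with 1 ≤ ℓ ≤ n. Then the total number of values computed by the truncated Fourier transform satisfies ∑_{s=1}^{p} ⌈ℓ / 2^{p−s}⌉ · 2^{p−s} ≤ ℓ·p + 2^p − 1, and in particular this sum is strictly less than ℓ·p + n. -/
theorem Finset.sum_Icc_two_pow_sub_add_one (p : ℕ) :
    (∑ s ∈ Finset.Icc 1 p, 2 ^ (p - s)) + 1 = 2 ^ p := by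
  induction p with
  | zero => simp
  | succ p ih =>
    have h : ∑ s ∈ Finset.Icc 1 p, 2 ^ (p + 1 - s) = 2 * ∑ s ∈ Finset.Icc 1 p, 2 ^ (p - s) := by
      rw [Finset.mul_sum]
      refine Finset.sum_congr rfl fun s hs => ?_
      rw [Nat.succ_sub (Finset.mem_Icc.mp hs).2, pow_succ']
    rw [Finset.sum_Icc_succ_top (by omega), h, Nat.sub_self, pow_zero, pow_succ]
    omega


/-- Operation count of the truncated Fourier transform: for `1 ≤ ℓ ≤ n = 2^p` (`p ≥ 1`),
the number `∑_{s=1}^{p} ⌈ℓ / 2^{p−s}⌉·2^{p−s}` of values computed is at most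
`ℓ·p + 2^p − 1`, and in particular strictly less than `ℓ·p + n`.
(Here `⌈ℓ/m⌉ = (ℓ + m − 1)/m` in natural-number arithmetic.) -/
theorem tft_operation_count (p ℓ : ℕ) (hp : 1 ≤ p) (hℓ : 1 ≤ ℓ) (hℓn : ℓ ≤ 2 ^ p) :
    (∑ s ∈ Finset.Icc 1 p, ((ℓ + 2 ^ (p - s) - 1) / 2 ^ (p - s)) * 2 ^ (p - s))
        ≤ ℓ * p + 2 ^ p - 1 ∧
      (∑ s ∈ Finset.Icc 1 p, ((ℓ + 2 ^ (p - s) - 1) / 2 ^ (p - s)) * 2 ^ (p - s))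
        < ℓ * p + 2 ^ p := by
  have hsum : (∑ s ∈ Finset.Icc 1 p, ((ℓ + 2 ^ (p - s) - 1) / 2 ^ (p - s)) * 2 ^ (p - s))
      ≤ ∑ s ∈ Finset.Icc 1 p, (ℓ + 2 ^ (p - s)) :=
    Finset.sum_le_sum fun s _ => (Nat.div_mul_le_self _ _).trans (Nat.sub_le _ _)
  rw [Finset.sum_add_distrib, Finset.sum_const, Nat.card_Icc, Nat.add_sub_cancel, smul_eq_mul,
    mul_comm p] at hsum
  have hgeom := Finset.sum_Icc_two_pow_sub_add_one p
  constructor <;> omega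
end

section
/- Let R be an integral domain, n a positive natural number, and ω ∈ R a primitive n-th root of unity. Let P, Q ∈ R[x] be polynomials with deg(P·Q) < n, and let p, q, c ∈ R^n be the length-n coefficient vectors of P, Q, and P·Q respectively (padded with zeros). Then for every k with 0 ≤ k < n, n · c_k = DFT_{ω⁻¹}( DFT_ω(p) ⊙ DFT_ω(q) )_k, where ⊙ denotes the componentwise product of vectors and ω⁻¹ = ω^{n−1}. -/
open Polynomial

theorem dft_coeff_eq_eval {R : Type*} [CommRing R] {n : ℕ} (ω : R) {A : R[X]}
    (hA : A.natDegree < n) (i : ℕ) : dft n ω A.coeff i = A.eval (ω ^ i) := by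
  simp only [dft, eval_eq_sum_range' hA, pow_mul]

/-- Orthogonality of the powers of a primitive root of unity. -/
theorem IsPrimitiveRoot.sum_pow_mul_pow_sub_one {R : Type*} [CommRing R] [IsDomain R]
    {n : ℕ} {ω : R} (hω : IsPrimitiveRoot ω n) {j k : ℕ} (hj : j < n) (hk : k < n) :
    ∑ i ∈ Finset.range n, (ω ^ j * (ω ^ (n - 1)) ^ k) ^ i = if j = k then (n : R) else 0 := by
  have hn : n ≠ 0 := by lia
  have hinv : (ω ^ (n - 1)) ^ k * ω ^ k = 1 := by
    rw [← mul_pow, pow_sub_one_mul hn, hω.pow_eq_one, one_pow]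
  split_ifs with h
  · subst h
    simp [mul_comm (ω ^ j), hinv]
  · set x := ω ^ j * (ω ^ (n - 1)) ^ k with hx
    have hx1 : x ≠ 1 := fun h1 => h <| hω.pow_inj hj hk <| by
      rw [← one_mul (ω ^ k), ← h1, hx, mul_assoc, hinv, mul_one]
    have hxn : x ^ n = 1 := by
      rw [hx, ← pow_mul, ← pow_add, ← pow_mul, mul_comm, pow_mul, hω.pow_eq_one, one_pow]
    refine (mul_eq_zero.mp ?_).resolve_right (sub_ne_zero.mpr hx1)
    rw [geom_sum_mul, hxn, sub_self]

/-- Fourier inversion. -/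
theorem dft_pow_sub_one_dft {R : Type*} [CommRing R] [IsDomain R]
    {n : ℕ} {ω : R} (hω : IsPrimitiveRoot ω n) (a : ℕ → R) {k : ℕ} (hk : k < n) :
    dft n (ω ^ (n - 1)) (dft n ω a) k = n * a k := by
  calc dft n (ω ^ (n - 1)) (dft n ω a) k
      = ∑ j ∈ Finset.range n,
          a j * ∑ i ∈ Finset.range n, (ω ^ j * (ω ^ (n - 1)) ^ k) ^ i := by
        simp only [dft, Finset.sum_mul, Finset.mul_sum]
        rw [Finset.sum_comm]
        refine Finset.sum_congr rfl fun j _ => Finset.sum_congr rfl fun i _ => ?_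
        rw [mul_pow, ← pow_mul ω j, ← pow_mul (ω ^ (n - 1)), mul_comm i j, mul_assoc]
    _ = ∑ j ∈ Finset.range n, a j * if j = k then (n : R) else 0 :=
        Finset.sum_congr rfl fun j hj => by
          rw [hω.sum_pow_mul_pow_sub_one (Finset.mem_range.mp hj) hk]
    _ = n * a k := by simp [hk, mul_comm]

/-- FFT-based polynomial multiplication: for an integral domain `R`, `n > 0`, `ω` a
primitive `n`-th root of unity, and polynomials `P, Q` with `deg(P·Q) < n`, the
length-`n` coefficient vector `c` of `P·Q` satisfies
`n · c_k = DFT_{ω⁻¹}(DFT_ω(p) ⊙ DFT_ω(q))_k` for all `k < n`, where `⊙` is the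
componentwise product and `ω⁻¹ = ω^{n−1}`. -/
theorem dft_polynomial_multiplication {R : Type*} [CommRing R] [IsDomain R]
    (n : ℕ) (hn : 0 < n) (ω : R) (hω : IsPrimitiveRoot ω n)
    (P Q : R[X]) (hdeg : (P * Q).degree < (n : ℕ)) :
    ∀ k < n,
      (n : R) * (P * Q).coeff k =
        dft n (ω ^ (n - 1)) (fun i => dft n ω P.coeff i * dft n ω Q.coeff i) k := by
  intro k hk
  by_cases h0 : P * Q = 0
  · rcases mul_eq_zero.mp h0 with rfl | rfl <;> simp [dft]
  · obtain ⟨hP, hQ⟩ := mul_ne_zero_iff.mp h0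
    have hPQ : (P * Q).natDegree < n := (natDegree_lt_iff_degree_lt h0).mpr hdeg
    have hadd := natDegree_mul hP hQ
    have hmul : (fun i => dft n ω P.coeff i * dft n ω Q.coeff i) = dft n ω (P * Q).coeff := by
      funext i
      rw [dft_coeff_eq_eval ω hPQ, dft_coeff_eq_eval ω (by lia : P.natDegree < n),
        dft_coeff_eq_eval ω (by lia : Q.natDegree < n), eval_mul]
    rw [hmul, dft_pow_sub_one_dft hω _ hk]
end

section
/- Let R be an integral domain, p a natural number, n = 2^p, and ω ∈ R a primitive n-th root of unity. Let ℓ be a natural number with 1 ≤ ℓ ≤ n. Then the truncated Fourier transform TFT_ω: R^ℓ → R^ℓ, which sends (a_0, …, a_{ℓ−1}) to the ℓ-tuple (A(ω^{[0]_p}), A(ω^{[1]_p}), …, A(ω^{[ℓ−1]_p})) where A(x) = a_0 + a_1 x + ⋯ + a_{ℓ−1}x^{ℓ−1}, is injective. -/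
theorem bitrev_lt (p i : ℕ) : bitrev p i < 2 ^ p := by
  induction p generalizing i with
  | zero => simp [bitrev]
  | succ p ih =>
    have := ih (i / 2)
    rcases Nat.mod_two_eq_zero_or_one i with h | h <;> simp only [bitrev, h, pow_succ] <;> omega

theorem bitrev_injOn (p : ℕ) : Set.InjOn (bitrev p) {i | i < 2 ^ p} := by
  induction p with
  | zero =>
    intro i hi j hj _
    simp only [Set.mem_ofPred_eq, pow_zero] at hi hj
    omega
  | succ p ih =>
    intro i hi j hj h
    simp only [Set.mem_ofPred_eq, pow_succ] at hi hj
    have hbi := bitrev_lt p (i / 2)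
    have hbj := bitrev_lt p (j / 2)
    have hhalf : bitrev p (i / 2) = bitrev p (j / 2) → i / 2 = j / 2 := fun h =>
      ih (Nat.div_lt_of_lt_mul (by omega)) (Nat.div_lt_of_lt_mul (by omega)) h
    rcases Nat.mod_two_eq_zero_or_one i with hi' | hi' <;>
      rcases Nat.mod_two_eq_zero_or_one j with hj' | hj' <;>
      simp only [bitrev, hi', hj'] at h <;> omega

/-- Injectivity of the truncated Fourier transform: for an integral domain `R`,
`n = 2^p`, `ω` a primitive `n`-th root of unity, and `1 ≤ ℓ ≤ n`, the map
`TFT_ω : R^ℓ → R^ℓ`, `(a_0, …, a_{ℓ−1}) ↦ (A(ω^{[i]_p}))_{i<ℓ}` with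
`A(x) = a_0 + a_1 x + ⋯ + a_{ℓ−1} x^{ℓ−1}`, is injective. -/
theorem tft_injective {R : Type*} [CommRing R] [IsDomain R]
    (p : ℕ) (ω : R) (hω : IsPrimitiveRoot ω (2 ^ p))
    (ℓ : ℕ) (hℓ : 1 ≤ ℓ) (hℓn : ℓ ≤ 2 ^ p) :
    Function.Injective
      (fun (a : Fin ℓ → R) (i : Fin ℓ) =>
        ∑ j : Fin ℓ, a j * (ω ^ bitrev p i.val) ^ j.val) := by
  intro a b hab
  rw [← sub_eq_zero]
  refine Matrix.eq_zero_of_forall_index_sum_mul_pow_eq_zero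
    (f := fun i : Fin ℓ => ω ^ bitrev p i.val) (fun i j hij => ?_) (fun i => ?_)
  · have hi := i.isLt.trans_le hℓn
    have hj := j.isLt.trans_le hℓn
    exact Fin.ext <| bitrev_injOn p hi hj <|
      hω.pow_inj (bitrev_lt p i.val) (bitrev_lt p j.val) hij
  · simpa [sub_mul, sub_eq_zero] using congrFun hab i
end
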